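/- (Duality lemma.) Let α̃ ∈ ℝ and α₀, α₁, α₂ ≥ 0. The Strichartz estimate ‖ |∇|^{α̃} ρ_{e^{itΔ} γ₀ e^{−itΔ}} ‖_{L²_t(ℝ; H^{α₀}_x)} ≲ ‖⟨∇⟩^{α₁} γ₀ ⟨∇⟩^{α₂}‖_{𝔖²} (with some constant, for all Hilbert–Schmidt γ₀) holds if and only if the dual inequality ‖ |ξ|^{α̃} ⟨ξ⟩^{α₀} Ṽ(−|η|² + |ξ−η|², ξ) / (⟨η⟩^{α₁} ⟨ξ−η⟩^{α₂}) ‖_{L²_ξ L²_η(ℝ^d × ℝ^d)} ≲ ‖Ṽ(τ,ξ)‖_{L²_τ L²_ξ(ℝ × ℝ^d)} holds (with some constant, for all space-time functions V). -/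

import Mathlib

open MeasureTheory Complex Filter
open scoped ENNReal NNReal RealInnerProductSpace Topology ComplexConjugate

noncomputable section

/-- `d`-dimensional Euclidean space `ℝ^d`. -/
abbrev Vd (d : ℕ) := EuclideanSpace ℝ (Fin d)

/-- The Japanese bracket `⟨ξ⟩ = (1 + |ξ|²)^{1/2}`. -/
noncomputable def jb {d : ℕ} (ξ : Vd d) : ℝ := (1 + ‖ξ‖ ^ 2) ^ ((1 : ℝ) / 2)

/-- Fourier transform, with the paper's convention `ĥ(ξ) = ∫ e^{-i x·ξ} h(x) dx`. -/
noncomputable def ft {d : ℕ} (h : Vd d → ℂ) (ξ : Vd d) : ℂ :=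
  ∫ x : Vd d, Complex.exp (-(Complex.I * Complex.ofReal (⟪x, ξ⟫))) * h x

/-- Inverse Fourier transform `ǧ(x) = (2π)^{-d} ∫ e^{i x·ξ} g(ξ) dξ`. -/
noncomputable def invFt {d : ℕ} (h : Vd d → ℂ) (x : Vd d) : ℂ :=
  (((2 * Real.pi) ^ d)⁻¹ : ℝ) • ∫ ξ : Vd d, Complex.exp (Complex.I * Complex.ofReal (⟪x, ξ⟫)) * h ξ

/-- The space Fourier transform (at frequency `ξ`, time `t`) of the density of
`e^{itΔ} γ₀ e^{-itΔ}`, expressed via `G = γ̂₀`, the `2d`-dimensional Fourier transform of the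
integral kernel of `γ₀`:  `ρ̂(t,ξ) = (2π)^{-d} ∫ e^{-it(|η|²-|ξ-η|²)} G(η, ξ-η) dη`. -/
noncomputable def densFT {d : ℕ} (G : Vd d × Vd d → ℂ) (t : ℝ) (ξ : Vd d) : ℂ :=
  (((2 * Real.pi) ^ d)⁻¹ : ℝ) •
    ∫ η : Vd d, Complex.exp (-(Complex.I * Complex.ofReal (t * (‖η‖ ^ 2 - ‖ξ - η‖ ^ 2)))) * G (η, ξ - η)

/-- `‖ |∇|^s ρ_{e^{itΔ}γ₀e^{-itΔ}} ‖_{L²_t(ℝ; H^{α₀}_x)}`, computed on the space Fourier side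
(by Plancherel) from `G = γ̂₀`. -/
noncomputable def densStriNorm {d : ℕ} (s α₀ : ℝ) (G : Vd d × Vd d → ℂ) : ℝ≥0∞ :=
  (∫⁻ t : ℝ, ∫⁻ ξ : Vd d,
      ENNReal.ofReal (‖ξ‖ ^ (2 * s) * jb ξ ^ (2 * α₀)) * (‖densFT G t ξ‖₊ : ℝ≥0∞) ^ (2:ℝ)) ^ ((1:ℝ)/2)

/-- The weighted Hilbert–Schmidt norm `‖⟨∇⟩^{α₁} γ₀ ⟨∇⟩^{α₂}‖_{𝔖²}`, computed (by Plancherel)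
from `G = γ̂₀`. -/
noncomputable def wHSnorm {d : ℕ} (α₁ α₂ : ℝ) (G : Vd d × Vd d → ℂ) : ℝ≥0∞ :=
  (∫⁻ p : Vd d × Vd d,
      ENNReal.ofReal (jb p.1 ^ (2 * α₁) * jb p.2 ^ (2 * α₂)) * (‖G p‖₊ : ℝ≥0∞) ^ (2:ℝ)) ^ ((1:ℝ)/2)

/-- The dual weighted norm
`‖ |ξ|^{s} ⟨ξ⟩^{α₀} Ṽ(-|η|²+|ξ-η|², ξ) / (⟨η⟩^{α₁} ⟨ξ-η⟩^{α₂}) ‖_{L²_ξ L²_η}`,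
where `W = Ṽ` is the space-time Fourier transform of `V` (here `q = (ξ, η)`). -/
noncomputable def dualStriNorm {d : ℕ} (s α₀ α₁ α₂ : ℝ) (W : ℝ × Vd d → ℂ) : ℝ≥0∞ :=
  (∫⁻ q : Vd d × Vd d,
      ENNReal.ofReal
        ((‖q.1‖ ^ (2 * s) * jb q.1 ^ (2 * α₀)) /
          (jb q.2 ^ (2 * α₁) * jb (q.1 - q.2) ^ (2 * α₂))) *
      (‖W (-‖q.2‖ ^ 2 + ‖q.1 - q.2‖ ^ 2, q.1)‖₊ : ℝ≥0∞) ^ (2:ℝ)) ^ ((1:ℝ)/2)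

/-- The `L²_{τ,ξ}` norm of a space-time (Fourier) function. -/
noncomputable def l2full {d : ℕ} (W : ℝ × Vd d → ℂ) : ℝ≥0∞ :=
  (∫⁻ z : ℝ × Vd d, (‖W z‖₊ : ℝ≥0∞) ^ (2:ℝ)) ^ ((1:ℝ)/2)

lemma measurable_fourierChar_comp {α : Type*} [MeasurableSpace α] {f : α → ℝ}
    (hf : Measurable f) : Measurable fun x ↦ (Real.fourierChar (f x) : ℂ) :=
  (continuous_subtype_val.comp Real.continuous_fourierChar).measurable.comp hf

open FourierTransform in
/-- Fubini's theorem for an oscillatory integral with an arbitrary measurable phase. -/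
lemma integral_oscillatory_mul_eq {Y : Type*} [MeasurableSpace Y] {μ : Measure Y} [SFinite μ]
    {H : Y → ℂ} (hH : Integrable H μ) {φ : Y → ℝ} (hφ : Measurable φ) {V : ℝ → ℂ}
    (hV : Integrable V) :
    ∫ t, (∫ y, Real.fourierChar (-(t * φ y)) • H y ∂μ) * V t = ∫ y, H y * 𝓕 V (φ y) ∂μ := by
  simp_rw [Real.fourier_real_eq, ← integral_mul_const, ← integral_const_mul]
  rw [integral_integral_swap]
  · simp only [Circle.smul_def, smul_eq_mul]
    congr! 4
    ring
  · refine (hV.mul_prod hH).mono ?_ (ae_of_all _ fun p ↦ ?_)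
    · simp only [Function.uncurry_def, Circle.smul_def, smul_eq_mul]
      exact ((measurable_fourierChar_comp (by fun_prop)).aestronglyMeasurable.mul
        hH.1.comp_snd).mul hV.1.comp_fst
    · simp only [Function.uncurry_def, norm_mul, Circle.norm_smul]
      rw [mul_comm]

open FourierTransform SchwartzMap in
/-- The Fourier transform does not increase the `L²` norm of integrable functions. -/
lemma lintegral_enorm_fourier_sq_le {f : ℝ → ℂ} (hf : Integrable f) (hf2 : MemLp f 2) :
    ∫⁻ x, ‖𝓕 f x‖ₑ ^ (2 : ℝ) ≤ ∫⁻ x, ‖f x‖ₑ ^ (2 : ℝ) := by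
  set F : Lp ℂ 2 (volume : Measure ℝ) := hf2.toLp f
  have hcont : Continuous (𝓕 f) := VectorFourier.fourierIntegral_continuous
    Real.continuous_fourierChar (by fun_prop) hf
  have key : (𝓕 F : Lp ℂ 2 (volume : Measure ℝ)) =ᵐ[volume] 𝓕 f := by
    refine ae_eq_of_integral_contDiff_smul_eq ((Lp.memLp _).locallyIntegrable (by norm_num))
      hcont.locallyIntegrable fun g hg hgs ↦ ?_
    have hgs' : HasCompactSupport (fun x ↦ (g x : ℂ)) :=
      hgs.comp_left (g := fun r : ℝ ↦ (r : ℂ)) Complex.ofReal_zero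
    let g' : 𝓢(ℝ, ℂ) := hgs'.toSchwartzMap (Complex.ofRealCLM.contDiff.comp hg)
    have h1 := congrArg (fun T ↦ T g') (Lp.fourier_toTemperedDistribution_eq F)
    simp only [TemperedDistribution.fourier_apply, Lp.toTemperedDistribution_apply] at h1
    have h2 := integral_oscillatory_mul_eq hf measurable_id g'.integrable
    simp only [id] at h2
    calc _ = ∫ x, g' x • (𝓕 F : Lp ℂ 2 (volume : Measure ℝ)) x := rfl
      _ = ∫ x, (𝓕 g') x • F x := h1.symm
      _ = ∫ x, f x * 𝓕 (g' : ℝ → ℂ) x := by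
        refine integral_congr_ae ?_
        filter_upwards [hf2.coeFn_toLp] with x hx
        simp only [F, hx, smul_eq_mul, SchwartzMap.fourier_coe, mul_comm]
      _ = _ := by
        rw [← h2]
        congr! 2 with x
        simp_rw [Real.fourier_real_eq, Complex.real_smul, mul_comm x]
        exact mul_comm _ (g x : ℂ)
  have h := Lp.norm_fourier_eq F
  rw [Lp.norm_def, Lp.norm_def, ENNReal.toReal_eq_toReal_iff' (Lp.eLpNorm_ne_top _)
    (Lp.eLpNorm_ne_top _), eLpNorm_congr_ae key, eLpNorm_congr_ae hf2.coeFn_toLp] at h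
  rw [eLpNorm_eq_lintegral_rpow_enorm_toReal (by norm_num) (by norm_num),
    eLpNorm_eq_lintegral_rpow_enorm_toReal (by norm_num) (by norm_num)] at h
  simpa using (ENNReal.rpow_left_injective (by norm_num) h).le

open FourierTransform SchwartzMap in
/-- The inverse Fourier transform does not increase the `L²` norm of Schwartz functions. -/
lemma lintegral_enorm_fourierInv_sq_le (f : 𝓢(ℝ, ℂ)) :
    ∫⁻ x, ‖𝓕⁻ (f : ℝ → ℂ) x‖ₑ ^ (2 : ℝ) ≤ ∫⁻ x, ‖f x‖ₑ ^ (2 : ℝ) := by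
  have h := lintegral_enorm_fourier_sq_le f.integrable (f.memLp 2)
  simp_rw [Real.fourierInv_eq_fourier_neg]
  rwa [(Measure.measurePreserving_neg (volume : Measure ℝ)).lintegral_comp_emb
    (MeasurableEquiv.neg ℝ).measurableEmbedding (fun x ↦ ‖𝓕 (f : ℝ → ℂ) x‖ₑ ^ (2 : ℝ))]

/-- The oscillatory integral `∫ e^{-2πi t φ(ξ, η)} H(ξ, η) dη`. -/
def oscInt {d : ℕ} (φ : Vd d × Vd d → ℝ) (H : Vd d × Vd d → ℂ) (t : ℝ) (ξ : Vd d) : ℂ :=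
  ∫ η, Real.fourierChar (-(t * φ (ξ, η))) • H (ξ, η)

lemma stronglyMeasurable_oscInt {d : ℕ} {φ : Vd d × Vd d → ℝ} (hφ : Measurable φ)
    {H : Vd d × Vd d → ℂ} (hH : StronglyMeasurable H) :
    StronglyMeasurable fun p : ℝ × Vd d ↦ oscInt φ H p.1 p.2 := by
  refine StronglyMeasurable.integral_prod_right' (f := fun z : (ℝ × Vd d) × Vd d ↦
    Real.fourierChar (-(z.1.1 * φ (z.1.2, z.2))) • H (z.1.2, z.2)) ?_
  simp only [Circle.smul_def, smul_eq_mul]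
  exact (measurable_fourierChar_comp (by fun_prop)).stronglyMeasurable.mul
    (hH.comp_measurable (by fun_prop))

lemma enorm_oscInt_le {d : ℕ} (φ : Vd d × Vd d → ℝ) (H : Vd d × Vd d → ℂ) (t : ℝ) (ξ : Vd d) :
    ‖oscInt φ H t ξ‖ₑ ≤ ∫⁻ η, ‖H (ξ, η)‖ₑ := by
  refine (enorm_integral_le_lintegral_enorm _).trans (le_of_eq ?_)
  congr! 2
  rw [← ofReal_norm, Circle.norm_smul, ofReal_norm]

open FourierTransform in
lemma stronglyMeasurable_fourier_slice {X : Type*} [MeasurableSpace X] {V : ℝ × X → ℂ}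
    (hV : StronglyMeasurable V) :
    StronglyMeasurable fun z : ℝ × X ↦ 𝓕 (fun t ↦ V (t, z.2)) z.1 := by
  simp_rw [Real.fourier_real_eq]
  refine StronglyMeasurable.integral_prod_right' (f := fun y : (ℝ × X) × ℝ ↦
    Real.fourierChar (-(y.2 * y.1.1)) • V (y.2, y.1.2)) ?_
  simp only [Circle.smul_def, smul_eq_mul]
  exact (measurable_fourierChar_comp (by fun_prop)).stronglyMeasurable.mul
    (hV.comp_measurable (by fun_prop))

open FourierTransform in
lemma stronglyMeasurable_fourierInv_slice {X : Type*} [MeasurableSpace X] {V : ℝ × X → ℂ}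
    (hV : StronglyMeasurable V) :
    StronglyMeasurable fun z : ℝ × X ↦ 𝓕⁻ (fun t ↦ V (t, z.2)) z.1 := by
  simp_rw [Real.fourierInv_eq_fourier_neg]
  exact (stronglyMeasurable_fourier_slice hV).comp_measurable
    (g := fun z : ℝ × X ↦ (-z.1, z.2)) (by fun_prop)

/-- An absorption form of the Cauchy–Schwarz inequality. -/
lemma le_mul_lintegral_sq_of_le_lintegral_mul {α : Type*} [MeasurableSpace α] {μ : Measure α}
    {f g : α → ℝ≥0∞} (hf : AEMeasurable f μ) (hg : AEMeasurable g μ) {x K : ℝ≥0∞} (hx : x ≠ ⊤)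
    (hfg : x ≤ ∫⁻ a, f a * g a ∂μ) (hgK : ∫⁻ a, g a ^ (2 : ℝ) ∂μ ≤ K * x) :
    x ≤ K * ∫⁻ a, f a ^ (2 : ℝ) ∂μ := by
  rcases eq_or_ne x 0 with rfl | hx0
  · simp
  have h := hfg.trans (ENNReal.lintegral_mul_le_Lp_mul_Lq μ Real.HolderConjugate.two_two hf hg)
  have h2 := ENNReal.rpow_le_rpow h (show (0 : ℝ) ≤ 2 by norm_num)
  rw [ENNReal.mul_rpow_of_nonneg _ _ (by norm_num), ← ENNReal.rpow_mul, ← ENNReal.rpow_mul] at h2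
  norm_num at h2
  have h3 : x * x ≤ (K * ∫⁻ a, f a ^ (2 : ℝ) ∂μ) * x := by
    calc x * x = x ^ 2 := (sq x).symm
      _ ≤ _ := by simpa using h2
      _ ≤ (∫⁻ a, f a ^ (2 : ℝ) ∂μ) * (K * x) := mul_le_mul' (by simp) (by simpa using hgK)
      _ = _ := by ring
  exact (ENNReal.mul_le_mul_iff_left hx0 hx).1 h3

lemma memLp_of_bound_of_support {α : Type*} [MeasurableSpace α] {μ : Measure α} {f : α → ℂ}
    (hf : AEStronglyMeasurable f μ) {s : Set α} (hs : MeasurableSet s) (hμ : μ s ≠ ⊤) {B : ℝ}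
    (hB : ∀ x, ‖f x‖ ≤ B) (h0 : ∀ x ∉ s, f x = 0) (p : ℝ≥0∞) : MemLp f p μ := by
  have hi : s.indicator f = f := Set.indicator_eq_self.2 fun x hx ↦ by
    by_contra h
    exact hx (h0 x h)
  rw [← hi, memLp_indicator_iff_restrict hs]
  have : IsFiniteMeasure (μ.restrict s) := ⟨by simpa using hμ.lt_top⟩
  exact MemLp.of_bound hf.restrict B (ae_of_all _ hB)

lemma lintegral_enorm_sq_eq_enorm_integral {α : Type*} [MeasurableSpace α] {μ : Measure α}
    {f g : α → ℂ} (hf : MemLp f 2 μ) (hg : ∀ x, g x = ((‖f x‖ ^ 2 : ℝ) : ℂ)) :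
    ∫⁻ x, ‖f x‖ₑ ^ (2 : ℝ) ∂μ = ‖∫ x, g x ∂μ‖ₑ := by
  simp_rw [hg]
  rw [integral_complex_ofReal, ← ofReal_norm, Complex.norm_real, Real.norm_of_nonneg
    (by positivity), ofReal_integral_eq_lintegral_ofReal
      ((memLp_two_iff_integrable_sq_norm hf.1).1 hf) (ae_of_all _ fun x ↦ by positivity)]
  congr! 2 with x
  rw [ENNReal.ofReal_pow (norm_nonneg _), ofReal_norm]
  simp

lemma lintegral_eq_iSup_setLIntegral {α : Type*} [MeasurableSpace α] {μ : Measure α}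
    {S : ℕ → Set α} (hS : Monotone S) {f : α → ℝ≥0∞} (h0 : ∀ x ∉ ⋃ n, S n, f x = 0) :
    ∫⁻ x, f x ∂μ = ⨆ n, ∫⁻ x in S n, f x ∂μ := by
  rw [← setLIntegral_iUnion_of_directed f hS.directed_le]
  refine (setLIntegral_eq_of_support_subset ?_).symm
  exact Function.support_subset_iff'.2 h0

lemma lintegral_volume_prod {α β : Type*} [MeasureSpace α] [MeasureSpace β]
    [SFinite (volume : Measure β)] {f : α × β → ℝ≥0∞} (hf : Measurable f) :
    ∫⁻ p, f p = ∫⁻ x, ∫⁻ y, f (x, y) :=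
  lintegral_prod _ hf.aemeasurable

lemma lintegral_volume_prod_symm {α β : Type*} [MeasureSpace α] [MeasureSpace β]
    [SFinite (volume : Measure α)] [SFinite (volume : Measure β)] {f : α × β → ℝ≥0∞}
    (hf : Measurable f) : ∫⁻ p, f p = ∫⁻ y, ∫⁻ x, f (x, y) :=
  lintegral_prod_symm' _ hf

open FourierTransform in
/-- The dual inequality implies the bound for the oscillatory integral operator. -/
lemma oscInt_bound_of_dual {d : ℕ} {φ : Vd d × Vd d → ℝ} (hφ : Measurable φ) {u : Vd d → ℝ}
    (hu : Measurable u) {m : Vd d × Vd d → ℝ} (hm : Measurable m) (hm0 : ∀ q, m q ≠ 0) {K : ℝ≥0∞}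
    (hdual : ∀ W : ℝ × Vd d → ℂ, StronglyMeasurable W →
      ∫⁻ q : Vd d × Vd d, ‖(u q.1 / m q) • W (φ q, q.1)‖ₑ ^ (2 : ℝ)
        ≤ K * ∫⁻ z, ‖W z‖ₑ ^ (2 : ℝ))
    {H : Vd d × Vd d → ℂ} (hH : StronglyMeasurable H) :
    ∫⁻ p : ℝ × Vd d, ‖u p.2 • oscInt φ H p.1 p.2‖ₑ ^ (2 : ℝ)
      ≤ K * ∫⁻ q, ‖m q • H q‖ₑ ^ (2 : ℝ) := by
  have hD := stronglyMeasurable_oscInt hφ hH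
  have hI : Measurable fun ξ : Vd d ↦ ∫⁻ η, ‖H (ξ, η)‖ₑ := hH.enorm.lintegral_prod_right'
  let S : ℕ → Set (ℝ × Vd d) := fun N ↦
    {p | |p.1| ≤ N ∧ ‖p.2‖ ≤ N ∧ |u p.2| ≤ N ∧ ∫⁻ η, ‖H (p.2, η)‖ₑ ≤ N}
  have hS : ∀ N, MeasurableSet (S N) := fun N ↦ by
    simp only [S, Set.ofPred_and]
    refine (measurableSet_le ?_ ?_).inter ((measurableSet_le ?_ ?_).inter
      ((measurableSet_le ?_ ?_).inter (measurableSet_le (hI.comp measurable_snd)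
        measurable_const))) <;> fun_prop
  have hSmono : Monotone S := fun N N' hN p hp ↦ by
    have h1 : (N : ℝ) ≤ N' := by exact_mod_cast hN
    have h2 : (N : ℝ≥0∞) ≤ N' := by exact_mod_cast hN
    exact ⟨hp.1.trans h1, hp.2.1.trans h1, hp.2.2.1.trans h1, hp.2.2.2.trans h2⟩
  have hnot : ∀ t ξ, ∫⁻ η, ‖H (ξ, η)‖ₑ = ⊤ → oscInt φ H t ξ = 0 := fun t ξ h ↦ by
    refine integral_undef fun hi ↦ ?_
    refine hi.2.ne ((lintegral_congr fun η ↦ ?_).trans h)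
    rw [← ofReal_norm, Circle.norm_smul, ofReal_norm]
  rw [lintegral_eq_iSup_setLIntegral hSmono]
  swap
  · intro p hp
    rw [hnot, smul_zero, enorm_zero, ENNReal.zero_rpow_of_pos (by norm_num)]
    by_contra h
    refine hp (Set.mem_iUnion.2 ?_)
    obtain ⟨N, hN⟩ := exists_nat_ge (max (max |p.1| ‖p.2‖) (max |u p.2|
      (∫⁻ η, ‖H (p.2, η)‖ₑ).toReal))
    simp only [max_le_iff] at hN
    refine ⟨N, hN.1.1, hN.1.2, hN.2.1, ?_⟩
    simpa using (ENNReal.le_ofReal_iff_toReal_le h (by positivity)).2 hN.2.2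
  refine iSup_le fun N ↦ ?_
  let V : ℝ × Vd d → ℂ := (S N).indicator fun p ↦ u p.2 • conj (oscInt φ H p.1 p.2)
  have hVm : StronglyMeasurable V := by
    refine StronglyMeasurable.indicator ?_ (hS N)
    exact (hu.comp measurable_snd).stronglyMeasurable.smul
      (Complex.continuous_conj.comp_stronglyMeasurable hD)
  have hVB : ∀ p, ‖V p‖ ≤ N * N := fun p ↦ by
    by_cases hp : p ∈ S N
    · simp only [V, Set.indicator_of_mem hp, norm_smul, Real.norm_eq_abs, RCLike.norm_conj]
      refine mul_le_mul hp.2.2.1 ?_ (norm_nonneg _) (by positivity)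
      have := (enorm_oscInt_le φ H p.1 p.2).trans hp.2.2.2
      rw [← ofReal_norm, ← ENNReal.ofReal_natCast] at this
      exact (ENNReal.ofReal_le_ofReal_iff (by positivity)).1 this
    · simp only [V, Set.indicator_of_notMem hp, norm_zero]
      positivity
  have hX : ∫⁻ p in S N, ‖u p.2 • oscInt φ H p.1 p.2‖ₑ ^ (2 : ℝ) = ∫⁻ p, ‖V p‖ₑ ^ (2 : ℝ) := by
    rw [← lintegral_indicator (hS N)]
    refine lintegral_congr fun p ↦ ?_
    by_cases hp : p ∈ S N
    · simp only [V, Set.indicator_of_mem hp, enorm_smul]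
      congr 2
      simp [← ofReal_norm]
    · simp [V, Set.indicator_of_notMem hp]
  have hslice : ∀ ξ (r : ℝ≥0∞), MemLp (fun t ↦ V (t, ξ)) r := fun ξ r ↦ by
    refine memLp_of_bound_of_support
      (hVm.comp_measurable measurable_prodMk_right).aestronglyMeasurable
      (measurableSet_Icc (a := (-N : ℝ)) (b := N)) (by simp) (fun t ↦ hVB (t, ξ)) (fun t ht ↦ ?_) r
    have htS : (t, ξ) ∉ S N := fun h ↦ ht (abs_le.1 h.1)
    simp [V, htS]
  have hV2 : MemLp V 2 := by
    refine memLp_of_bound_of_support hVm.aestronglyMeasurable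
      ((measurableSet_Icc (a := (-N : ℝ)) (b := N)).prod
        (Metric.isClosed_closedBall (x := (0 : Vd d)) (ε := N)).measurableSet) ?_ hVB
        (fun p hp ↦ ?_) 2
    · rw [Measure.volume_eq_prod, Measure.prod_prod]
      exact ENNReal.mul_ne_top (by simp) measure_closedBall_lt_top.ne
    · have hpS : p ∉ S N := fun h ↦ hp ⟨abs_le.1 h.1, by simpa using h.2.1⟩
      simp [V, hpS]
  obtain ⟨W, hW, hWV⟩ : ∃ W : ℝ × Vd d → ℂ, StronglyMeasurable W ∧
      ∀ x ξ, W (x, ξ) = 𝓕 (fun t ↦ V (t, ξ)) x :=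
    ⟨_, stronglyMeasurable_fourier_slice hVm, fun _ _ ↦ rfl⟩
  have hfin : ∫⁻ p, ‖V p‖ₑ ^ (2 : ℝ) ≠ ⊤ := by
    have := (lintegral_rpow_enorm_lt_top_of_eLpNorm_lt_top (by norm_num) (by norm_num)
      hV2.2).ne
    simpa using this
  have hfm : Measurable fun q ↦ ‖m q • H q‖ₑ := (hm.stronglyMeasurable.smul hH).enorm
  have hgm : Measurable fun q : Vd d × Vd d ↦
      ‖(u q.1 / m q) • W (φ q, q.1)‖ₑ := by
    have h1 : Measurable fun q : Vd d × Vd d ↦ W (φ q, q.1) :=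
      hW.measurable.comp (hφ.prodMk measurable_fst)
    fun_prop
  rw [hX]
  refine le_mul_lintegral_sq_of_le_lintegral_mul (g := fun q : Vd d × Vd d ↦
    ‖(u q.1 / m q) • W (φ q, q.1)‖ₑ)
    hfm.aemeasurable hgm.aemeasurable hfin ?_ ?_
  · rw [lintegral_volume_prod_symm (hVm.enorm.pow_const _),
      lintegral_volume_prod (f := fun q : Vd d × Vd d ↦
        ‖m q • H q‖ₑ * ‖(u q.1 / m q) • W (φ q, q.1)‖ₑ) (hfm.mul hgm)]
    refine lintegral_mono fun ξ ↦ ?_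
    by_cases hHi : ∫⁻ η, ‖H (ξ, η)‖ₑ = ⊤
    · have : ∀ t, V (t, ξ) = 0 := fun t ↦ by simp [V, Set.indicator, hnot t ξ hHi]
      simp [this]
    have hHint : Integrable (fun η ↦ H (ξ, η)) :=
      ⟨(hH.comp_measurable measurable_prodMk_left).aestronglyMeasurable, lt_top_iff_ne_top.2 hHi⟩
    rw [lintegral_enorm_sq_eq_enorm_integral (hslice ξ 2)
      (g := fun t ↦ u ξ * (oscInt φ H t ξ * V (t, ξ)))]
    · simp only [oscInt]
      rw [integral_const_mul, integral_oscillatory_mul_eq hHint (by fun_prop)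
        (memLp_one_iff_integrable.1 (hslice ξ 1)), ← integral_const_mul]
      refine (enorm_integral_le_lintegral_enorm _).trans (lintegral_mono fun η ↦ le_of_eq ?_)
      simp only [← enorm_mul, hWV]
      congr 1
      have : (m (ξ, η) : ℂ) ≠ 0 := Complex.ofReal_ne_zero.2 (hm0 (ξ, η))
      simp only [Complex.real_smul]
      push_cast
      field_simp
    · intro t
      by_cases hp : (t, ξ) ∈ S N
      · simp only [V, Set.indicator_of_mem hp]
        simp only [Complex.real_smul, norm_mul, RCLike.norm_conj]
        push_cast
        rw [mul_pow, ← Complex.mul_conj' (oscInt φ H t ξ), ← Complex.ofReal_pow, norm_real,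
          Real.norm_eq_abs, sq_abs]
        push_cast
        ring
      · simp [V, Set.indicator_of_notMem hp]
  · refine (hdual _ hW).trans (mul_le_mul_right ?_ K)
    rw [lintegral_volume_prod_symm (hW.enorm.pow_const _),
      lintegral_volume_prod_symm (hVm.enorm.pow_const _)]
    simp only [hWV]
    exact lintegral_mono fun ξ ↦ lintegral_enorm_fourier_sq_le
      (memLp_one_iff_integrable.1 (hslice ξ 1)) (hslice ξ 2)

open FourierTransform SchwartzMap ContDiff in
/-- The bound for the oscillatory integral operator implies the dual inequality on test
functions. -/
lemma dual_bound_of_oscInt_bound {d : ℕ} {φ : Vd d × Vd d → ℝ} (hφ : Measurable φ) {u : Vd d → ℝ}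
    (hu : Measurable u) {m : Vd d × Vd d → ℝ} (hm : Measurable m) (hm0 : ∀ q, m q ≠ 0) {K : ℝ≥0∞}
    (hosc : ∀ H : Vd d × Vd d → ℂ, StronglyMeasurable H →
      ∫⁻ p : ℝ × Vd d, ‖u p.2 • oscInt φ H p.1 p.2‖ₑ ^ (2 : ℝ)
        ≤ K * ∫⁻ q, ‖m q • H q‖ₑ ^ (2 : ℝ))
    {W : ℝ × Vd d → ℂ} (hWs : HasCompactSupport W) (hWc : ContDiff ℝ ∞ W) :
    ∫⁻ q : Vd d × Vd d, ‖(u q.1 / m q) • W (φ q, q.1)‖ₑ ^ (2 : ℝ)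
      ≤ K * ∫⁻ z, ‖W z‖ₑ ^ (2 : ℝ) := by
  have hW : StronglyMeasurable W := hWc.continuous.stronglyMeasurable
  obtain ⟨B, hB⟩ := hWc.continuous.bounded_above_of_compact_support hWs
  have hB0 : 0 ≤ B := (norm_nonneg _).trans (hB 0)
  have hslice : ∀ ξ, ∃ f : 𝓢(ℝ, ℂ), ∀ t, f t = W (t, ξ) := fun ξ ↦ by
    have hs : HasCompactSupport fun t ↦ W (t, ξ) :=
      HasCompactSupport.intro (hWs.isCompact.image continuous_fst) fun t ht ↦ by
        by_contra h
        exact ht ⟨(t, ξ), subset_tsupport _ h, rfl⟩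
    exact ⟨hs.toSchwartzMap (hWc.comp (contDiff_id.prodMk contDiff_const)), fun t ↦ rfl⟩
  choose f hf using hslice
  have hf' : ∀ ξ, (fun t ↦ W (t, ξ)) = f ξ := fun ξ ↦ funext fun t ↦ (hf ξ t).symm
  obtain ⟨V, hV, hVW⟩ : ∃ V : ℝ × Vd d → ℂ, StronglyMeasurable V ∧
      ∀ ξ, (fun t ↦ V (t, ξ)) = (𝓕⁻ (f ξ) : 𝓢(ℝ, ℂ)) := by
    refine ⟨_, stronglyMeasurable_fourierInv_slice hW, fun ξ ↦ ?_⟩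
    rw [SchwartzMap.fourierInv_coe, ← hf']
  have hVint : ∀ ξ, Integrable fun t ↦ V (t, ξ) := fun ξ ↦ by
    rw [hVW]
    exact (𝓕⁻ (f ξ)).integrable
  have hFV : ∀ x ξ, 𝓕 (fun t ↦ V (t, ξ)) x = W (x, ξ) := fun x ξ ↦ by
    rw [hVW, ← SchwartzMap.fourier_coe, FourierTransform.fourier_fourierInv_eq, hf]
  have hWφ : StronglyMeasurable fun q : Vd d × Vd d ↦ (u q.1 / m q) • W (φ q, q.1) := by
    have h1 : StronglyMeasurable fun q : Vd d × Vd d ↦ W (φ q, q.1) :=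
      hW.comp_measurable (hφ.prodMk measurable_fst)
    exact ((hu.comp measurable_fst).div hm).stronglyMeasurable.smul h1
  let S : ℕ → Set (Vd d × Vd d) := fun N ↦
    {q | ‖q.1‖ ≤ N ∧ ‖q.2‖ ≤ N ∧ |u q.1 / m q| ≤ N ∧ |(m q)⁻¹| ≤ N}
  have hS : ∀ N, MeasurableSet (S N) := fun N ↦ by
    simp only [S, Set.ofPred_and]
    refine (measurableSet_le ?_ ?_).inter ((measurableSet_le ?_ ?_).inter
      ((measurableSet_le ?_ ?_).inter (measurableSet_le ?_ ?_))) <;> fun_prop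
  have hSmono : Monotone S := fun N N' hN p hp ↦ by
    have h1 : (N : ℝ) ≤ N' := by exact_mod_cast hN
    exact ⟨hp.1.trans h1, hp.2.1.trans h1, hp.2.2.1.trans h1, hp.2.2.2.trans h1⟩
  have hball : ∀ r : ℝ, MeasurableSet (Metric.closedBall (0 : Vd d) r) := fun r ↦
    Metric.isClosed_closedBall.measurableSet
  rw [lintegral_eq_iSup_setLIntegral hSmono]
  swap
  · intro q hq
    refine (hq (Set.mem_iUnion.2 ?_)).elim
    obtain ⟨N, hN⟩ := exists_nat_ge (max (max ‖q.1‖ ‖q.2‖) (max |u q.1 / m q| |(m q)⁻¹|))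
    simp only [max_le_iff] at hN
    exact ⟨N, hN.1.1, hN.1.2, hN.2.1, hN.2.2⟩
  refine iSup_le fun N ↦ ?_
  let F : Vd d × Vd d → ℂ := (S N).indicator fun q ↦ (u q.1 / m q) • W (φ q, q.1)
  have hF : StronglyMeasurable F := hWφ.indicator (hS N)
  have hFB : ∀ q, ‖F q‖ ≤ N * B := fun q ↦ by
    by_cases hq : q ∈ S N
    · simp only [F, Set.indicator_of_mem hq, norm_smul, Real.norm_eq_abs]
      exact mul_le_mul hq.2.2.1 (hB _) (norm_nonneg _) (by positivity)
    · simp only [F, Set.indicator_of_notMem hq, norm_zero]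
      positivity
  let H : Vd d × Vd d → ℂ := fun q ↦ (m q)⁻¹ • conj (F q)
  have hH : StronglyMeasurable H :=
    hm.inv.stronglyMeasurable.smul (Complex.continuous_conj.comp_stronglyMeasurable hF)
  have hHB : ∀ q, ‖H q‖ ≤ N * (N * B) := fun q ↦ by
    by_cases hq : q ∈ S N
    · simp only [H, norm_smul, Real.norm_eq_abs, RCLike.norm_conj]
      exact mul_le_mul hq.2.2.2 (hFB _) (norm_nonneg _) (by positivity)
    · simp only [H, F, Set.indicator_of_notMem hq, map_zero, smul_zero, norm_zero]
      positivity
  have hX : ∫⁻ q in S N, ‖(u q.1 / m q) • W (φ q, q.1)‖ₑ ^ (2 : ℝ)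
      = ∫⁻ q, ‖F q‖ₑ ^ (2 : ℝ) := by
    rw [← lintegral_indicator (hS N)]
    refine lintegral_congr fun p ↦ ?_
    by_cases hp : p ∈ S N
    · simp only [F, Set.indicator_of_mem hp]
    · simp [F, Set.indicator_of_notMem hp]
  have hF2 : MemLp F 2 := by
    refine memLp_of_bound_of_support hF.aestronglyMeasurable
      ((hball N).prod (hball N)) ?_ hFB (fun q hq ↦ ?_) 2
    · rw [Measure.volume_eq_prod, Measure.prod_prod]
      exact ENNReal.mul_ne_top measure_closedBall_lt_top.ne measure_closedBall_lt_top.ne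
    · have hqS : q ∉ S N := fun h ↦ hq ⟨by simpa using h.1, by simpa using h.2.1⟩
      simp [F, hqS]
  have hout : ∀ ξ η, η ∉ Metric.closedBall (0 : Vd d) N → F (ξ, η) = 0 := fun ξ η hη ↦ by
    have hqS : (ξ, η) ∉ S N := fun h ↦ hη (by simpa using h.2.1)
    simp [F, hqS]
  have hFslice : ∀ ξ, MemLp (fun η ↦ F (ξ, η)) 2 := fun ξ ↦
    memLp_of_bound_of_support (hF.comp_measurable measurable_prodMk_left).aestronglyMeasurable
      (hball N) measure_closedBall_lt_top.ne (fun η ↦ hFB (ξ, η)) (fun η hη ↦ hout ξ η hη) 2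
  have hHslice : ∀ ξ, Integrable fun η ↦ H (ξ, η) := fun ξ ↦
    memLp_one_iff_integrable.1 <| memLp_of_bound_of_support
      (hH.comp_measurable measurable_prodMk_left).aestronglyMeasurable
      (hball N) measure_closedBall_lt_top.ne (fun η ↦ hHB (ξ, η))
      (fun η hη ↦ by simp [H, hout ξ η hη]) 1
  have hmH : ∀ q, ‖m q • H q‖ₑ = ‖F q‖ₑ := fun q ↦ by
    simp only [H, smul_smul, mul_inv_cancel₀ (hm0 q), one_smul]
    simp [← ofReal_norm]
  have hfin : ∫⁻ q, ‖F q‖ₑ ^ (2 : ℝ) ≠ ⊤ := by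
    have := (lintegral_rpow_enorm_lt_top_of_eLpNorm_lt_top (by norm_num) (by norm_num)
      hF2.2).ne
    simpa using this
  have hD := stronglyMeasurable_oscInt hφ hH
  have hgm : Measurable fun p : ℝ × Vd d ↦ ‖u p.2 • oscInt φ H p.1 p.2‖ₑ :=
    ((hu.comp measurable_snd).stronglyMeasurable.smul hD).enorm
  rw [hX]
  refine (le_mul_lintegral_sq_of_le_lintegral_mul (f := fun p ↦ ‖V p‖ₑ)
    (g := fun p : ℝ × Vd d ↦ ‖u p.2 • oscInt φ H p.1 p.2‖ₑ) (μ := volume) (K := K)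
    hV.enorm.aemeasurable hgm.aemeasurable hfin ?_ ?_).trans (mul_le_mul_right ?_ K)
  · rw [lintegral_volume_prod (hF.enorm.pow_const _),
      lintegral_volume_prod_symm (f := fun p : ℝ × Vd d ↦ ‖V p‖ₑ * ‖u p.2 • oscInt φ H p.1 p.2‖ₑ)
        (hV.enorm.mul hgm)]
    refine lintegral_mono fun ξ ↦ ?_
    rw [lintegral_enorm_sq_eq_enorm_integral (hFslice ξ)
      (g := fun η ↦ u ξ * (H (ξ, η) * 𝓕 (fun t ↦ V (t, ξ)) (φ (ξ, η))))]
    · rw [integral_const_mul, ← integral_oscillatory_mul_eq (hHslice ξ) (by fun_prop) (hVint ξ),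
        ← integral_const_mul]
      refine (enorm_integral_le_lintegral_enorm _).trans (lintegral_mono fun t ↦ le_of_eq ?_)
      simp only [← enorm_mul, oscInt, Complex.real_smul]
      congr 1
      ring
    · intro η
      rw [hFV]
      by_cases hq : (ξ, η) ∈ S N
      · have hne : (m (ξ, η) : ℂ) ≠ 0 := Complex.ofReal_ne_zero.2 (hm0 _)
        have hFe : F (ξ, η) = (u ξ / m (ξ, η)) • W (φ (ξ, η), ξ) := by
          simp only [F, Set.indicator_of_mem hq]
        push_cast
        rw [← Complex.mul_conj' (F (ξ, η))]
        simp only [H]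
        generalize conj (F (ξ, η)) = c
        rw [hFe]
        simp only [Complex.real_smul]
        push_cast
        field_simp
      · simp [H, F, Set.indicator_of_notMem hq]
  · refine (hosc H hH).trans_eq ?_
    simp only [hmH]
  · rw [lintegral_volume_prod_symm (hV.enorm.pow_const _),
      lintegral_volume_prod_symm (hW.enorm.pow_const _)]
    refine lintegral_mono fun ξ ↦ ?_
    have h1 : ∀ t, V (t, ξ) = 𝓕⁻ (f ξ : ℝ → ℂ) t := fun t ↦ by
      rw [← SchwartzMap.fourierInv_coe, ← hVW]
    simp only [h1, ← hf]
    exact lintegral_enorm_fourierInv_sq_le (f ξ)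

lemma lintegral_enorm_sq_eq_eLpNorm {α : Type*} [MeasurableSpace α] {μ : Measure α} (f : α → ℂ) :
    ∫⁻ x, ‖f x‖ₑ ^ (2 : ℝ) ∂μ = eLpNorm f 2 μ ^ (2 : ℝ) := by
  rw [eLpNorm_eq_lintegral_rpow_enorm_toReal (by norm_num) (by norm_num), ← ENNReal.rpow_mul]
  simp

open ContDiff in
/-- A weighted `L²` bound for a composition operator extends from test functions to `L²`. -/
lemma lintegral_comp_sq_le_of_testFunction {E α : Type*} [NormedAddCommGroup E] [NormedSpace ℝ E]
    [FiniteDimensional ℝ E] [MeasurableSpace E] [BorelSpace E] [MeasurableSpace α] {ν : Measure E}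
    [IsFiniteMeasureOnCompacts ν] {μ : Measure α} {Φ : α → E}
    (hΦ : Measure.QuasiMeasurePreserving Φ μ ν) {w : α → ℝ} (hw : Measurable w) {K : ℝ≥0∞}
    (hK : K ≠ ⊤)
    (htest : ∀ g : E → ℂ, HasCompactSupport g → ContDiff ℝ ∞ g →
      ∫⁻ q, ‖w q • g (Φ q)‖ₑ ^ (2 : ℝ) ∂μ ≤ K * ∫⁻ z, ‖g z‖ₑ ^ (2 : ℝ) ∂ν)
    {W : E → ℂ} (hW : MemLp W 2 ν) :
    ∫⁻ q, ‖w q • W (Φ q)‖ₑ ^ (2 : ℝ) ∂μ ≤ K * ∫⁻ z, ‖W z‖ₑ ^ (2 : ℝ) ∂ν := by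
  have happ : ∀ n : ℕ, ∃ g : E → ℂ, HasCompactSupport g ∧ ContDiff ℝ ∞ g ∧
      eLpNorm (W - g) 2 ν ≤ ENNReal.ofReal (1 / ((n : ℝ) + 1)) := fun n ↦
    MemLp.exist_eLpNorm_sub_le (by norm_num) (by norm_num) hW (by positivity)
  choose g hgs hgc hg using happ
  have hε : Tendsto (fun n : ℕ ↦ ENNReal.ofReal (1 / ((n : ℝ) + 1))) atTop (𝓝 0) := by
    simpa using ENNReal.tendsto_ofReal tendsto_one_div_add_atTop_nhds_zero_nat
  have hgm : ∀ n, AEStronglyMeasurable (g n) ν := fun n ↦ (hgc n).continuous.aestronglyMeasurable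
  obtain ⟨ns, hns, hae⟩ := (tendstoInMeasure_of_tendsto_eLpNorm (p := 2) (by norm_num) hgm hW.1
    (tendsto_of_tendsto_of_tendsto_of_le_of_le tendsto_const_nhds hε (fun _ ↦ zero_le)
      fun n ↦ (eLpNorm_sub_comm _ _ _ _).trans_le (hg n))).exists_seq_tendsto_ae
  have hlim : ∀ᵐ q ∂μ, ‖w q • W (Φ q)‖ₑ ^ (2 : ℝ)
      = liminf (fun n ↦ ‖w q • g (ns n) (Φ q)‖ₑ ^ (2 : ℝ)) atTop := by
    filter_upwards [hΦ.ae hae] with q hq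
    exact ((ENNReal.continuous_rpow_const.tendsto _).comp
      (hq.const_smul (w q)).enorm).liminf_eq.symm
  rw [lintegral_congr_ae hlim]
  refine (lintegral_liminf_le fun n ↦ ?_).trans ?_
  · have h1 : Measurable fun q ↦ g (ns n) (Φ q) := (hgc _).continuous.measurable.comp hΦ.measurable
    exact (hw.smul h1).enorm.pow_const _
  have hT : Tendsto (fun n ↦ K * (eLpNorm W 2 ν + ENNReal.ofReal (1 / ((ns n : ℝ) + 1))) ^ (2 : ℝ))
      atTop (𝓝 (K * ∫⁻ z, ‖W z‖ₑ ^ (2 : ℝ) ∂ν)) := by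
    rw [lintegral_enorm_sq_eq_eLpNorm]
    refine ENNReal.Tendsto.const_mul ?_ (Or.inr hK)
    refine (ENNReal.continuous_rpow_const.tendsto _).comp ?_
    simpa using (tendsto_const_nhds (x := eLpNorm W 2 ν)).add (hε.comp hns.tendsto_atTop)
  rw [← hT.liminf_eq]
  refine liminf_le_liminf (Eventually.of_forall fun n ↦ (htest _ (hgs _) (hgc _)).trans ?_)
  rw [lintegral_enorm_sq_eq_eLpNorm]
  refine mul_le_mul_right (ENNReal.rpow_le_rpow ?_ (by norm_num)) K
  have h2 : g (ns n) = W - (W - g (ns n)) := by simp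
  rw [h2]
  exact (eLpNorm_sub_le hW.1 (hW.1.sub (hgm _)) (by norm_num)).trans (by gcongr; exact hg _)

lemma quasiMeasurePreserving_inner_add {d : ℕ} {ξ : Vd d} (hξ : ξ ≠ 0) {a : ℝ} (ha : a ≠ 0)
    (b : ℝ) : Measure.QuasiMeasurePreserving (fun η : Vd d ↦ a * ⟪ξ, η⟫ + b) := by
  have hL : Measure.QuasiMeasurePreserving (a • innerₛₗ ℝ ξ) (volume : Measure (Vd d)) volume := by
    refine ⟨(LinearMap.continuous_of_finiteDimensional _).measurable, ?_⟩
    obtain ⟨c, -, hc⟩ := LinearMap.exists_map_addHaar_eq_smul_addHaar (a • innerₛₗ ℝ ξ)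
      (volume : Measure (Vd d)) (volume : Measure ℝ)
      (LinearMap.surjective fun h ↦ by simpa [ha, hξ] using LinearMap.congr_fun h ξ)
    rw [hc]
    exact Measure.smul_absolutelyContinuous
  exact (measurePreserving_add_right (volume : Measure ℝ) b).quasiMeasurePreserving.comp hL

lemma quasiMeasurePreserving_phase {d : ℕ} (hd : 1 ≤ d) {φ : Vd d × Vd d → ℝ} (hφ : Measurable φ)
    {a : ℝ} (ha : a ≠ 0) {b : Vd d → ℝ} (hab : ∀ ξ η, φ (ξ, η) = a * ⟪ξ, η⟫ + b ξ) :
    Measure.QuasiMeasurePreserving fun q : Vd d × Vd d ↦ (φ q, q.1) := by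
  have hmeas : Measurable fun q : Vd d × Vd d ↦ (φ q, q.1) := hφ.prodMk measurable_fst
  have : Nonempty (Fin d) := ⟨⟨0, hd⟩⟩
  refine ⟨hmeas, fun s hs ↦ ?_⟩
  obtain ⟨s', hss, hs'm, hs'0⟩ := exists_measurable_superset_of_null hs
  refine measure_mono_null hss ?_
  rw [Measure.map_apply hmeas hs'm, Measure.volume_eq_prod,
    Measure.measure_prod_null (hmeas hs'm)]
  rw [Measure.volume_eq_prod, ← Measure.prod_swap,
    Measure.map_apply measurable_swap hs'm,
    Measure.measure_prod_null (measurable_swap hs'm)] at hs'0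
  have h0 : ∀ᵐ ξ : Vd d, ξ ≠ 0 := by simp [ae_iff]
  filter_upwards [hs'0, h0] with ξ h1 h2
  have h3 := (quasiMeasurePreserving_inner_add h2 ha (b ξ)).preimage_null h1
  simp only [← hab] at h3
  exact h3

lemma rpow_half_le_mul_rpow_half_iff {a b C : ℝ≥0∞} :
    a ^ ((1 : ℝ) / 2) ≤ C * b ^ ((1 : ℝ) / 2) ↔ a ≤ C ^ (2 : ℝ) * b := by
  have h : C * b ^ ((1 : ℝ) / 2) = (C ^ (2 : ℝ) * b) ^ ((1 : ℝ) / 2) := by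
    rw [ENNReal.mul_rpow_of_nonneg _ _ (by norm_num), ← ENNReal.rpow_mul]
    norm_num
  rw [h, ENNReal.rpow_le_rpow_iff (by norm_num)]

lemma exists_rpow_half_le_iff {ι : Type*} {P : ι → Prop} {a b : ι → ℝ≥0∞} :
    (∃ C : ℝ≥0, ∀ i, P i → a i ^ ((1 : ℝ) / 2) ≤ C * b i ^ ((1 : ℝ) / 2)) ↔
      ∃ C : ℝ≥0, ∀ i, P i → a i ≤ C * b i := by
  simp_rw [rpow_half_le_mul_rpow_half_iff]
  constructor
  · rintro ⟨C, hC⟩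
    refine ⟨C ^ (2 : ℝ), fun i hi ↦ ?_⟩
    rw [ENNReal.coe_rpow_of_nonneg _ (by norm_num)]
    exact hC i hi
  · rintro ⟨C, hC⟩
    refine ⟨C ^ ((1 : ℝ) / 2), fun i hi ↦ ?_⟩
    rw [ENNReal.coe_rpow_of_nonneg _ (by norm_num), ← ENNReal.rpow_mul]
    simpa using hC i hi

lemma enorm_smul_rpow_two (r : ℝ) (z : ℂ) :
    ‖r • z‖ₑ ^ (2 : ℝ) = ENNReal.ofReal (r ^ 2) * (‖z‖₊ : ℝ≥0∞) ^ (2 : ℝ) := by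
  rw [enorm_smul, ENNReal.mul_rpow_of_nonneg _ _ (by norm_num), ← sq_abs r,
    ENNReal.ofReal_pow (abs_nonneg r), ← Real.norm_eq_abs, ofReal_norm, ENNReal.rpow_two]
  rfl

lemma rpow_two_mul_eq_sq {x : ℝ} (hx : 0 ≤ x) (a : ℝ) : x ^ (2 * a) = (x ^ a) ^ 2 := by
  rw [mul_comm, Real.rpow_mul hx, Real.rpow_two]

lemma jb_pos {d : ℕ} (ξ : Vd d) : 0 < jb ξ := Real.rpow_pos_of_pos (by positivity) _

lemma measurable_jb {d : ℕ} : Measurable (jb : Vd d → ℝ) := by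
  unfold jb
  fun_prop

/-- The weight `|ξ|^s ⟨ξ⟩^α`. -/
def outWeight {d : ℕ} (s α : ℝ) (ξ : Vd d) : ℝ := ‖ξ‖ ^ s * jb ξ ^ α

lemma measurable_outWeight {d : ℕ} (s α : ℝ) : Measurable (outWeight s α : Vd d → ℝ) :=
  (measurable_norm.pow_const s).mul (measurable_jb.pow_const α)

/-- The weight `⟨η⟩^{α₁} ⟨ξ - η⟩^{α₂}` at `(ξ, η)`. -/
def inWeight {d : ℕ} (α₁ α₂ : ℝ) (q : Vd d × Vd d) : ℝ := jb q.2 ^ α₁ * jb (q.1 - q.2) ^ α₂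

lemma measurable_inWeight {d : ℕ} (α₁ α₂ : ℝ) :
    Measurable (inWeight α₁ α₂ : Vd d × Vd d → ℝ) :=
  ((measurable_jb.comp measurable_snd).pow_const α₁).mul
    ((measurable_jb.comp (measurable_fst.sub measurable_snd)).pow_const α₂)

lemma inWeight_ne_zero {d : ℕ} (α₁ α₂ : ℝ) (q : Vd d × Vd d) : inWeight α₁ α₂ q ≠ 0 :=
  (mul_pos (Real.rpow_pos_of_pos (jb_pos _) _) (Real.rpow_pos_of_pos (jb_pos _) _)).ne'

/-- The phase `(|η|² - |ξ - η|²) / 2π` at `(ξ, η)`. -/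
def phase {d : ℕ} (q : Vd d × Vd d) : ℝ := (‖q.2‖ ^ 2 - ‖q.1 - q.2‖ ^ 2) / (2 * Real.pi)

lemma measurable_phase {d : ℕ} : Measurable (phase : Vd d × Vd d → ℝ) := by
  unfold phase
  fun_prop

lemma phase_eq_inner {d : ℕ} (ξ η : Vd d) :
    phase (ξ, η) = Real.pi⁻¹ * ⟪ξ, η⟫ + -(‖ξ‖ ^ 2 / (2 * Real.pi)) := by
  simp only [phase, norm_sub_sq_real]
  field_simp
  ring

lemma measurePreserving_snd_sub {d : ℕ} :
    MeasurePreserving fun q : Vd d × Vd d ↦ (q.2, q.1 - q.2) := by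
  simpa only [neg_add_eq_sub, ← Measure.volume_eq_prod] using
    measurePreserving_prod_neg_add_swap (volume : Measure (Vd d)) (volume : Measure (Vd d))

lemma densFT_eq_oscInt {d : ℕ} (G : Vd d × Vd d → ℂ) (t : ℝ) (ξ : Vd d) :
    densFT G t ξ = (((2 * Real.pi) ^ d)⁻¹ : ℝ) • oscInt phase (fun q ↦ G (q.2, q.1 - q.2)) t ξ := by
  simp only [densFT, oscInt, Circle.smul_def, Real.fourierChar_apply, smul_eq_mul]
  congr! 5 with η
  simp only [phase]
  push_cast
  field_simp

lemma lintegral_densFT_eq {d : ℕ} (s α₀ : ℝ) {G : Vd d × Vd d → ℂ} (hG : StronglyMeasurable G) :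
    ∫⁻ t : ℝ, ∫⁻ ξ : Vd d, ENNReal.ofReal (‖ξ‖ ^ (2 * s) * jb ξ ^ (2 * α₀)) *
        (‖densFT G t ξ‖₊ : ℝ≥0∞) ^ (2 : ℝ) =
      ENNReal.ofReal ((((2 * Real.pi) ^ d)⁻¹) ^ 2) * ∫⁻ p : ℝ × Vd d,
        ‖outWeight s α₀ p.2 • oscInt phase (fun q ↦ G (q.2, q.1 - q.2)) p.1 p.2‖ₑ ^ (2 : ℝ) := by
  have hH : StronglyMeasurable fun q : Vd d × Vd d ↦ G (q.2, q.1 - q.2) :=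
    hG.comp_measurable (by fun_prop)
  have hm : Measurable fun p : ℝ × Vd d ↦
      ‖outWeight s α₀ p.2 • oscInt phase (fun q ↦ G (q.2, q.1 - q.2)) p.1 p.2‖ₑ ^ (2 : ℝ) :=
    (((measurable_outWeight s α₀).comp measurable_snd).stronglyMeasurable.smul
      (stronglyMeasurable_oscInt measurable_phase hH)).enorm.pow_const _
  rw [← lintegral_const_mul _ hm, lintegral_volume_prod (hm.const_mul _)]
  refine lintegral_congr fun t ↦ lintegral_congr fun ξ ↦ ?_
  rw [rpow_two_mul_eq_sq (norm_nonneg _), rpow_two_mul_eq_sq (jb_pos _).le, ← mul_pow,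
    ← enorm_smul_rpow_two, densFT_eq_oscInt, smul_comm]
  rw [enorm_smul_rpow_two (((2 * Real.pi) ^ d)⁻¹)]
  rfl

lemma lintegral_weight_eq {d : ℕ} (α₁ α₂ : ℝ) {G : Vd d × Vd d → ℂ} (hG : StronglyMeasurable G) :
    ∫⁻ p : Vd d × Vd d, ENNReal.ofReal (jb p.1 ^ (2 * α₁) * jb p.2 ^ (2 * α₂)) *
        (‖G p‖₊ : ℝ≥0∞) ^ (2 : ℝ) =
      ∫⁻ q, ‖inWeight α₁ α₂ q • G (q.2, q.1 - q.2)‖ₑ ^ (2 : ℝ) := by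
  have hm : Measurable fun p : Vd d × Vd d ↦
      ENNReal.ofReal (jb p.1 ^ (2 * α₁) * jb p.2 ^ (2 * α₂)) * (‖G p‖₊ : ℝ≥0∞) ^ (2 : ℝ) :=
    (((measurable_jb.comp measurable_fst).pow_const _).mul
      ((measurable_jb.comp measurable_snd).pow_const _)).ennreal_ofReal.mul
      (hG.enorm.pow_const _)
  rw [← measurePreserving_snd_sub.lintegral_comp hm]
  refine lintegral_congr fun q ↦ ?_
  rw [enorm_smul_rpow_two, inWeight, mul_pow, rpow_two_mul_eq_sq (jb_pos _).le,
    rpow_two_mul_eq_sq (jb_pos _).le]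

lemma lintegral_densFT_congr {d : ℕ} (w : Vd d → ℝ≥0∞) {G G' : Vd d × Vd d → ℂ}
    (h : G =ᵐ[volume] G') :
    ∫⁻ t : ℝ, ∫⁻ ξ : Vd d, w ξ * (‖densFT G t ξ‖₊ : ℝ≥0∞) ^ (2 : ℝ) =
      ∫⁻ t : ℝ, ∫⁻ ξ : Vd d, w ξ * (‖densFT G' t ξ‖₊ : ℝ≥0∞) ^ (2 : ℝ) := by
  have h1 := Measure.ae_ae_of_ae_prod
    (measurePreserving_snd_sub.quasiMeasurePreserving.ae_eq_comp h)
  refine lintegral_congr fun t ↦ lintegral_congr_ae ?_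
  filter_upwards [h1] with ξ hξ
  have h2 : densFT G t ξ = densFT G' t ξ := by
    unfold densFT
    congr 1
    refine integral_congr_ae ?_
    filter_upwards [hξ] with η hη
    rw [show G (η, ξ - η) = G' (η, ξ - η) from hη]
  rw [h2]

/-- The dilation `(x, ξ) ↦ (-2πx, ξ)` of the time frequency. -/
def timeDilation (d : ℕ) (z : ℝ × Vd d) : ℝ × Vd d := (-(2 * Real.pi) * z.1, z.2)

lemma measurable_timeDilation (d : ℕ) : Measurable (timeDilation d) := by
  unfold timeDilation
  fun_prop

lemma map_timeDilation (d : ℕ) : (volume : Measure (ℝ × Vd d)).map (timeDilation d) =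
    ENNReal.ofReal (2 * Real.pi)⁻¹ • volume := by
  have h : timeDilation d = Prod.map (fun x ↦ -(2 * Real.pi) * x) id := rfl
  rw [h, Measure.volume_eq_prod, ← Measure.map_prod_map _ _ (by fun_prop) measurable_id,
    Measure.map_id, Real.map_volume_mul_left (by simp [Real.pi_ne_zero]), Measure.prod_smul_left,
    inv_neg, abs_neg, abs_of_pos (by positivity)]

lemma quasiMeasurePreserving_timeDilation (d : ℕ) :
    Measure.QuasiMeasurePreserving (timeDilation d) :=
  ⟨measurable_timeDilation d, by
    rw [map_timeDilation]
    exact Measure.smul_absolutelyContinuous⟩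

lemma lintegral_comp_timeDilation {d : ℕ} {W : ℝ × Vd d → ℂ} (hW : AEStronglyMeasurable W) :
    ∫⁻ z, ‖W (timeDilation d z)‖ₑ ^ (2 : ℝ) =
      ENNReal.ofReal (2 * Real.pi)⁻¹ * ∫⁻ z, ‖W z‖ₑ ^ (2 : ℝ) := by
  rw [← smul_eq_mul, ← lintegral_smul_measure, ← map_timeDilation, lintegral_map'
    (f := fun z ↦ ‖W z‖ₑ ^ (2 : ℝ)) _ (measurable_timeDilation d).aemeasurable]
  rw [map_timeDilation]
  exact (hW.smul_measure _).enorm.pow_const _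

lemma lintegral_dual_eq {d : ℕ} (s α₀ α₁ α₂ : ℝ) (W : ℝ × Vd d → ℂ) :
    ∫⁻ q : Vd d × Vd d, ENNReal.ofReal ((‖q.1‖ ^ (2 * s) * jb q.1 ^ (2 * α₀)) /
          (jb q.2 ^ (2 * α₁) * jb (q.1 - q.2) ^ (2 * α₂))) *
        (‖W (-‖q.2‖ ^ 2 + ‖q.1 - q.2‖ ^ 2, q.1)‖₊ : ℝ≥0∞) ^ (2 : ℝ) =
      ∫⁻ q : Vd d × Vd d, ‖(outWeight s α₀ q.1 / inWeight α₁ α₂ q) •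
        W (timeDilation d (phase q, q.1))‖ₑ ^ (2 : ℝ) := by
  refine lintegral_congr fun q ↦ ?_
  have h : timeDilation d (phase q, q.1) = (-‖q.2‖ ^ 2 + ‖q.1 - q.2‖ ^ 2, q.1) := by
    simp only [timeDilation, phase, Prod.mk.injEq, and_true]
    field_simp
    ring
  rw [h, enorm_smul_rpow_two, outWeight, inWeight, div_pow, mul_pow, mul_pow]
  simp only [rpow_two_mul_eq_sq (norm_nonneg _), rpow_two_mul_eq_sq (jb_pos _).le]

/-- Lemma 3.6, duality.  The Strichartz estimate
`‖ |∇|^{α̃} ρ_{e^{itΔ}γ₀e^{-itΔ}} ‖_{L²_t H^{α₀}_x} ≲ ‖⟨∇⟩^{α₁} γ₀ ⟨∇⟩^{α₂}‖_{𝔖²}`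
(for all Hilbert–Schmidt `γ₀`, described through `G = γ̂₀`) holds if and only if the dual
inequality
`‖ |ξ|^{α̃}⟨ξ⟩^{α₀} Ṽ(-|η|²+|ξ-η|²,ξ)/(⟨η⟩^{α₁}⟨ξ-η⟩^{α₂}) ‖_{L²_{ξ,η}} ≲ ‖Ṽ‖_{L²_{τ,ξ}}`
holds (for all space-time functions `V`, described through their space-time Fourier
transforms `W = Ṽ`). -/
theorem duality_lemma
    (d : ℕ) (hd : 1 ≤ d) (s α₀ α₁ α₂ : ℝ) (h₀ : 0 ≤ α₀) (h₁ : 0 ≤ α₁) (h₂ : 0 ≤ α₂) :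
    (∃ C : ℝ≥0, ∀ G : Vd d × Vd d → ℂ, AEStronglyMeasurable G volume →
      densStriNorm s α₀ G ≤ C * wHSnorm α₁ α₂ G) ↔
    (∃ C : ℝ≥0, ∀ W : ℝ × Vd d → ℂ, AEStronglyMeasurable W volume →
      dualStriNorm s α₀ α₁ α₂ W ≤ C * l2full W) := by
  unfold densStriNorm wHSnorm dualStriNorm l2full
  rw [exists_rpow_half_le_iff, exists_rpow_half_le_iff]
  have hc : ENNReal.ofReal ((((2 * Real.pi) ^ d)⁻¹) ^ 2) ≠ 0 := by
    simp
  have hb : ENNReal.ofReal (2 * Real.pi)⁻¹ ≠ 0 := by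
    simp [Real.pi_pos]
  constructor
  · rintro ⟨C, hC⟩
    set c := ENNReal.ofReal ((((2 * Real.pi) ^ d)⁻¹) ^ 2)
    have hosc : ∀ H : Vd d × Vd d → ℂ, StronglyMeasurable H →
        ∫⁻ p : ℝ × Vd d, ‖outWeight s α₀ p.2 • oscInt phase H p.1 p.2‖ₑ ^ (2 : ℝ)
          ≤ (c⁻¹ * C) * ∫⁻ q, ‖inWeight α₁ α₂ q • H q‖ₑ ^ (2 : ℝ) := fun H hH ↦ by
      have hG : StronglyMeasurable fun p : Vd d × Vd d ↦ H (p.1 + p.2, p.1) :=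
        hH.comp_measurable (by fun_prop)
      have h := hC _ hG.aestronglyMeasurable
      rw [lintegral_densFT_eq s α₀ hG, lintegral_weight_eq α₁ α₂ hG] at h
      simp only [add_sub_cancel, Prod.mk.eta] at h
      rw [mul_assoc, ← ENNReal.mul_le_iff_le_inv hc ENNReal.ofReal_ne_top]
      exact h
    have hK : c⁻¹ * C ≠ ⊤ := ENNReal.mul_ne_top (ENNReal.inv_ne_top.2 hc) ENNReal.coe_ne_top
    have hb' : ENNReal.ofReal (2 * Real.pi)⁻¹ ≠ ⊤ := ENNReal.ofReal_ne_top
    refine ⟨((c⁻¹ * C) * ENNReal.ofReal (2 * Real.pi)⁻¹).toNNReal + 1, fun W hW ↦ ?_⟩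
    rw [lintegral_dual_eq, ENNReal.coe_add, ENNReal.coe_toNNReal (ENNReal.mul_ne_top hK hb')]
    rcases eq_or_ne (∫⁻ z, (‖W z‖₊ : ℝ≥0∞) ^ (2 : ℝ)) ⊤ with htop | htop
    · rw [htop, ENNReal.mul_top (by simp)]
      exact le_top
    have hW' : AEStronglyMeasurable fun z ↦ W (timeDilation d z) :=
      hW.comp_quasiMeasurePreserving (quasiMeasurePreserving_timeDilation d)
    have hsq := lintegral_comp_timeDilation hW
    have hW2 : MemLp (fun z ↦ W (timeDilation d z)) 2 := by
      refine ⟨hW', ?_⟩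
      have h1 := hsq.trans_lt (ENNReal.mul_lt_top hb'.lt_top (lt_top_iff_ne_top.2 htop))
      rw [lintegral_enorm_sq_eq_eLpNorm] at h1
      exact (ENNReal.rpow_lt_top_iff_of_pos (by norm_num)).1 h1
    refine (lintegral_comp_sq_le_of_testFunction (quasiMeasurePreserving_phase hd measurable_phase
      (inv_ne_zero Real.pi_ne_zero) phase_eq_inner)
      (((measurable_outWeight s α₀).comp measurable_fst).div (measurable_inWeight α₁ α₂)) hK
      (fun g hgs hgc ↦ dual_bound_of_oscInt_bound measurable_phase (measurable_outWeight s α₀)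
        (measurable_inWeight α₁ α₂) (inWeight_ne_zero α₁ α₂) hosc hgs hgc) hW2).trans ?_
    rw [hsq, ← mul_assoc]
    exact mul_le_mul_left le_self_add _
  · rintro ⟨C, hC⟩
    set c := ENNReal.ofReal ((((2 * Real.pi) ^ d)⁻¹) ^ 2)
    set b := ENNReal.ofReal (2 * Real.pi)⁻¹
    have hdual : ∀ W : ℝ × Vd d → ℂ, StronglyMeasurable W →
        ∫⁻ q : Vd d × Vd d, ‖(outWeight s α₀ q.1 / inWeight α₁ α₂ q) • W (phase q, q.1)‖ₑ ^ (2 : ℝ)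
          ≤ (C * b⁻¹) * ∫⁻ z, ‖W z‖ₑ ^ (2 : ℝ) := fun W hW ↦ by
      let W' : ℝ × Vd d → ℂ := fun z ↦ W (-(2 * Real.pi)⁻¹ * z.1, z.2)
      have hW' : StronglyMeasurable W' := hW.comp_measurable (by fun_prop)
      have hWW : ∀ z, W' (timeDilation d z) = W z := fun z ↦ by
        simp only [W', timeDilation]
        congr 2
        field_simp
      have h := hC W' hW'.aestronglyMeasurable
      rw [lintegral_dual_eq] at h
      have hsq := lintegral_comp_timeDilation hW'.aestronglyMeasurable
      simp only [hWW] at h hsq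
      rw [hsq, mul_assoc, ENNReal.inv_mul_cancel_left hb ENNReal.ofReal_ne_top]
      exact h
    have hK : c * (C * b⁻¹) ≠ ⊤ := ENNReal.mul_ne_top ENNReal.ofReal_ne_top
      (ENNReal.mul_ne_top ENNReal.coe_ne_top (ENNReal.inv_ne_top.2 hb))
    refine ⟨(c * (C * b⁻¹)).toNNReal, fun G hG ↦ ?_⟩
    obtain ⟨G', hG', hGG'⟩ := hG
    rw [ENNReal.coe_toNNReal hK, lintegral_densFT_congr _ hGG', lintegral_densFT_eq s α₀ hG',
      lintegral_congr_ae (g := fun p : Vd d × Vd d ↦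
        ENNReal.ofReal (jb p.1 ^ (2 * α₁) * jb p.2 ^ (2 * α₂)) * (‖G' p‖₊ : ℝ≥0∞) ^ (2 : ℝ))
        (hGG'.mono fun p hp ↦ by simp only [hp]),
      lintegral_weight_eq α₁ α₂ hG', mul_assoc c]
    exact mul_le_mul_right (oscInt_bound_of_dual measurable_phase (measurable_outWeight s α₀)
      (measurable_inWeight α₁ α₂) (inWeight_ne_zero α₁ α₂) hdual
      (hG'.comp_measurable (by fun_prop))) c
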